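/- arXiv:1206.2691 — 3 statements merged into one kernel-verified Lean document; each statement's English description precedes it below -/
import Mathlib

section
/- Let A be a DFA, P ⊆ Σ* a live complete set for A with λ ∈ P, and V ⊆ Σ* with λ ∈ V such that V is closed for P. Then for all α, β ∈ P: E_V(α) = E_V(β) if and only if α and β are Nerode-equivalent with respect to L(A) (i.e., for every w ∈ Σ*, αw ∈ L(A) ⟺ βw ∈ L(A)). (At termination of partition refinement, the rows of strings in P exactly classify the Nerode classes of L(A).) -/
/-- The row of a string `x` with respect to a set `V` of distinguishing strings:
`E_V(x) = {v ∈ V : x ++ v ∈ L(A)}`. -/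
def row {α σ : Type*} (A : DFA α σ) (V : Set (List α)) (x : List α) : Set (List α) :=
  {v ∈ V | x ++ v ∈ A.accepts}

/-- A state is live if some string leads from it to an accepting state. -/
def Live {α σ : Type*} (A : DFA α σ) (q : σ) : Prop :=
  ∃ w : List α, A.evalFrom q w ∈ A.accept

/-- A finite set `P` of strings is live complete for `A` if every live state is reached
from the initial state by some string of `P`. -/
def LiveComplete {α σ : Type*} (A : DFA α σ) (P : Set (List α)) : Prop :=
  P.Finite ∧ ∀ q : σ, Live A q → ∃ a ∈ P, A.eval a = q

/-- `V` is closed for `P`: (a) equal rows of members of `P` remain equal after any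
one-symbol extension, and (b) empty rows of members of `P` remain empty after any
one-symbol extension. -/
def ClosedFor {α σ : Type*} (A : DFA α σ) (V P : Set (List α)) : Prop :=
  (∀ a ∈ P, ∀ c ∈ P, ∀ b : α,
      row A V a = row A V c → row A V (a ++ [b]) = row A V (c ++ [b])) ∧
  (∀ a ∈ P, ∀ b : α, row A V a = ∅ → row A V (a ++ [b]) = ∅)

/-- Strings leading to the same state accept the same continuations. -/
theorem append_mem_accepts_congr {α σ : Type*} (A : DFA α σ) {x y : List α}
    (h : A.eval x = A.eval y) (w : List α) : x ++ w ∈ A.accepts ↔ y ++ w ∈ A.accepts := by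
  simp only [DFA.eval] at h
  simp only [DFA.mem_accepts, DFA.eval, DFA.evalFrom_of_append, h]

theorem row_congr {α σ : Type*} (A : DFA α σ) (V : Set (List α)) {x y : List α}
    (h : A.eval x = A.eval y) : row A V x = row A V y := by
  ext v
  exact and_congr_right fun _ => append_mem_accepts_congr A h v

/-- A string with an accepted continuation leads to the same state as some string of `P`. -/
theorem LiveComplete.exists_eval_eq {α σ : Type*} {A : DFA α σ} {P : Set (List α)}
    (hP : LiveComplete A P) {x w : List α} (h : x ++ w ∈ A.accepts) :
    ∃ a ∈ P, A.eval a = A.eval x :=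
  hP.2 _ ⟨w, by simpa only [DFA.mem_accepts, DFA.eval, DFA.evalFrom_of_append] using h⟩

theorem ClosedFor.append_notMem_accepts_of_row_eq_empty {α σ : Type*} {A : DFA α σ}
    {P V : Set (List α)} (hcl : ClosedFor A V P) (hP : LiveComplete A P)
    (hV : ([] : List α) ∈ V) (w : List α) {a : List α} (ha : a ∈ P) (h : row A V a = ∅) :
    a ++ w ∉ A.accepts := by
  induction w generalizing a with
  | nil => exact fun hw => Set.eq_empty_iff_forall_notMem.1 h [] ⟨hV, hw⟩
  | cons b w ih =>
    intro hw
    rw [List.append_cons] at hw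
    obtain ⟨a', ha', he⟩ := hP.exists_eval_eq hw
    exact ih ha' ((row_congr A V he).trans (hcl.2 a ha b h))
      ((append_mem_accepts_congr A he w).2 hw)

theorem ClosedFor.append_mem_accepts_of_row_eq {α σ : Type*} {A : DFA α σ}
    {P V : Set (List α)} (hcl : ClosedFor A V P) (hP : LiveComplete A P)
    (hV : ([] : List α) ∈ V) (w : List α) {a c : List α} (ha : a ∈ P) (hc : c ∈ P)
    (h : row A V a = row A V c) (hw : a ++ w ∈ A.accepts) : c ++ w ∈ A.accepts := by
  induction w generalizing a c with
  | nil => exact (h ▸ (⟨hV, hw⟩ : [] ∈ row A V a) : [] ∈ row A V c).2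
  | cons b w ih =>
    rw [List.append_cons] at hw ⊢
    obtain ⟨a', ha', hae⟩ := hP.exists_eval_eq hw
    have hw' := (append_mem_accepts_congr A hae w).2 hw
    have hrow : row A V a' = row A V (c ++ [b]) :=
      (row_congr A V hae).trans (hcl.1 a ha c hc b h)
    have hne : row A V (c ++ [b]) ≠ ∅ := fun h0 =>
      hcl.append_notMem_accepts_of_row_eq_empty hP hV w ha' (hrow.trans h0) hw'
    obtain ⟨v, -, hv⟩ := Set.nonempty_iff_ne_empty.2 hne
    obtain ⟨c', hc', hce⟩ := hP.exists_eval_eq hv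
    exact (append_mem_accepts_congr A hce w).1
      (ih ha' hc' (hrow.trans (row_congr A V hce).symm) hw')

/-- At termination of partition refinement, for strings in the live complete set `P`,
equality of rows coincides with Nerode equivalence with respect to `L(A)`. -/
theorem row_eq_iff_nerode_on_P {α σ : Type*} [Fintype α] [Fintype σ]
    (A : DFA α σ) (P V : Set (List α)) (hP : LiveComplete A P)
    (hnilP : ([] : List α) ∈ P) (hnilV : ([] : List α) ∈ V) (hcl : ClosedFor A V P) :
    ∀ a ∈ P, ∀ c ∈ P,
      (row A V a = row A V c ↔
        ∀ w : List α, a ++ w ∈ A.accepts ↔ c ++ w ∈ A.accepts) := by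
  intro a ha c hc
  refine ⟨fun h w => ⟨hcl.append_mem_accepts_of_row_eq hP hnilV w ha hc h,
    hcl.append_mem_accepts_of_row_eq hP hnilV w hc ha h.symm⟩, fun h => ?_⟩
  ext v
  exact and_congr_right fun _ => h v
end

section
/- (Canonicity of the learned automaton.) Let A be a DFA, P ⊆ Σ* a live complete set for A with λ ∈ P, and V ⊆ Σ* with λ ∈ V such that V is closed for P, and let rep be any representative function for (V, P). Then the number of states of the hypothesis DFA M = M(A, V, P, rep) reachable from its start state equals the Myhill–Nerode index of L(A); that is, M restricted to its reachable states is the canonical (minimum-state) DFA for L(A). -/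
/-- `rep` is a representative function for `(V, P)`: it assigns to each nonempty row of a
string of `P` a string of `P` having that row. -/
def IsRepFun {α σ : Type*} (A : DFA α σ) (V P : Set (List α))
    (rep : Set (List α) → List α) : Prop :=
  ∀ r : Set (List α), (∃ a ∈ P, row A V a = r) → r ≠ ∅ →
    rep r ∈ P ∧ row A V (rep r) = r

open Classical in
/-- The transition function of the hypothesis DFA: on a nonempty row of a string of `P`,
step via a representative; on all other state names, go to the empty (dead) state. -/
noncomputable def hypStep {α σ : Type*} (A : DFA α σ) (V P : Set (List α))
    (rep : Set (List α) → List α) (r : Set (List α)) (b : α) : Set (List α) :=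
  if (∃ a ∈ P, row A V a = r) ∧ r ≠ ∅ then row A V (rep r ++ [b]) else ∅

/-- The hypothesis DFA `M(A, V, P, rep)`: states are subsets of `Σ*`, the start state is
`E_V(λ)`, accepting states are the rows containing `λ`, and transitions are `hypStep`. -/
noncomputable def hypDFA {α σ : Type*} (A : DFA α σ) (V P : Set (List α))
    (rep : Set (List α) → List α) : DFA α (Set (List α)) where
  step := hypStep A V P rep
  start := row A V []
  accept := {r : Set (List α) | [] ∈ r}

/-- The Nerode (right-congruence) setoid of a language. -/
def nerodeSetoid {α : Type*} (L : Language α) : Setoid (List α) where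
  r a c := ∀ w : List α, a ++ w ∈ L ↔ c ++ w ∈ L
  iseqv := ⟨fun _ _ => Iff.rfl, fun h w => (h w).symm, fun h1 h2 w => (h1 w).trans (h2 w)⟩

theorem row_congr_of_eval_eq {α σ : Type*} (A : DFA α σ) (V : Set (List α)) {x y : List α}
    (h : A.eval x = A.eval y) (z : List α) : row A V (x ++ z) = row A V (y ++ z) := by
  have key : ∀ w, x ++ w ∈ A.accepts ↔ y ++ w ∈ A.accepts := fun w => by
    have h' : A.evalFrom A.start x = A.evalFrom A.start y := h
    rw [DFA.mem_accepts, DFA.mem_accepts, DFA.eval, DFA.evalFrom_of_append,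
      DFA.evalFrom_of_append, h']
  ext v
  simp only [row, Set.mem_ofPred_eq, List.append_assoc, key]

theorem row_eq_empty_of_not_live {α σ : Type*} (A : DFA α σ) (V : Set (List α)) {x : List α}
    (h : ¬ Live A (A.eval x)) (z : List α) : row A V (x ++ z) = ∅ := by
  refine Set.eq_empty_of_forall_notMem fun v hv => h ⟨z ++ v, ?_⟩
  have hv' := hv.2
  rw [DFA.mem_accepts, List.append_assoc, DFA.eval, DFA.evalFrom_of_append] at hv'
  exact hv'

/-- The hypothesis DFA reaches the row of `x` after reading `x`. -/
theorem hypDFA_eval_eq_row {α σ : Type*} (A : DFA α σ) (V P : Set (List α))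
    (hP : ∀ q : σ, Live A q → ∃ a ∈ P, A.eval a = q) (hcl : ClosedFor A V P)
    (rep : Set (List α) → List α) (hrep : IsRepFun A V P rep) (x : List α) :
    (hypDFA A V P rep).eval x = row A V x := by
  induction x using List.reverseRecOn with
  | nil => rfl
  | append_singleton x b ih =>
    rw [DFA.eval_append_singleton, ih]
    change hypStep A V P rep (row A V x) b = _
    unfold hypStep
    by_cases hl : Live A (A.eval x)
    · obtain ⟨a, ha, hax⟩ := hP _ hl
      have hrow : row A V a = row A V x := by
        simpa using row_congr_of_eval_eq A V hax []
      have hext := row_congr_of_eval_eq A V hax [b]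
      by_cases hne : row A V x = ∅
      · rw [if_neg (fun h => h.2 hne), ← hext, hcl.2 a ha b (hrow.trans hne)]
      · have hr := hrep _ ⟨a, ha, hrow⟩ hne
        rw [if_pos ⟨⟨a, ha, hrow⟩, hne⟩, ← hext]
        exact hcl.1 _ hr.1 a ha b (hr.2.trans hrow.symm)
    · have hx : row A V x = ∅ := by simpa using row_eq_empty_of_not_live A V hl []
      rw [if_neg (fun h => h.2 hx), row_eq_empty_of_not_live A V hl [b]]

/-- Canonicity of the learned automaton: the number of states of the hypothesis DFA
reachable from its start state equals the Myhill–Nerode index of `L(A)`, i.e. the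
hypothesis DFA restricted to its reachable states is the canonical minimum-state DFA. -/
theorem hypDFA_canonical {α σ : Type*} [Fintype α] [Fintype σ]
    (A : DFA α σ) (V P : Set (List α)) (hP : LiveComplete A P)
    (hnilP : ([] : List α) ∈ P) (hnilV : ([] : List α) ∈ V) (hcl : ClosedFor A V P)
    (rep : Set (List α) → List α) (hrep : IsRepFun A V P rep) :
    (Set.range (hypDFA A V P rep).eval).ncard =
      Nat.card (Quotient (nerodeSetoid A.accepts)) := by
  have heval := hypDFA_eval_eq_row A V P hP.2 hcl rep hrep
  have hmem : ∀ x, x ∈ A.accepts ↔ [] ∈ row A V x := fun x => by simp [row, hnilV]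
  have hker : nerodeSetoid A.accepts = Setoid.ker (hypDFA A V P rep).eval := by
    ext x y
    rw [Setoid.ker_def, heval, heval]
    constructor
    · intro h
      ext v
      exact and_congr_right fun _ => h v
    · intro h w
      rw [← heval, ← heval] at h
      rw [hmem, hmem, ← heval, ← heval, DFA.eval, DFA.evalFrom_of_append,
        DFA.evalFrom_of_append]
      change _ ∈ DFA.evalFrom _ (DFA.eval _ x) w ↔ _ ∈ DFA.evalFrom _ (DFA.eval _ y) w
      rw [h]
  rw [hker, ← Nat.card_coe_set_eq]
  exact (Nat.card_congr (Setoid.quotientKerEquivRange _)).symm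
end

section
/- (Compatibility Theorem.) Let A be a DFA, P ⊆ Σ* a finite prefix-closed set (not assumed live complete) with λ ∈ P, and V ⊆ Σ* with λ ∈ V such that V is closed for P, and let rep be any representative function for (V, P). Then the hypothesis DFA M = M(A, V, P, rep) is compatible with A on P: for every α ∈ P, M accepts α if and only if α ∈ L(A). (Hence every intermediate hypothesis automaton produced by the prefix closed IDS algorithm classifies all strings observed so far exactly as the target automaton does.) -/
/-- A set of strings is prefix-closed if it contains every prefix of each of its members. -/
def PrefixClosed {α : Type*} (P : Set (List α)) : Prop :=
  ∀ x ∈ P, ∀ p : List α, p <+: x → p ∈ P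

theorem hypStep_row {α σ : Type*} {A : DFA α σ} {V P : Set (List α)}
    (hcl : ClosedFor A V P) {rep : Set (List α) → List α} (hrep : IsRepFun A V P rep)
    {a : List α} (ha : a ∈ P) (b : α) :
    hypStep A V P rep (row A V a) b = row A V (a ++ [b]) := by
  by_cases hr : row A V a = ∅
  · rw [hypStep, if_neg (fun h => h.2 hr), hcl.2 a ha b hr]
  · have hex : ∃ c ∈ P, row A V c = row A V a := ⟨a, ha, rfl⟩
    obtain ⟨hmem, hrow⟩ := hrep _ hex hr
    rw [hypStep, if_pos ⟨hex, hr⟩]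
    exact hcl.1 _ hmem a ha b hrow

theorem hypDFA_eval {α σ : Type*} {A : DFA α σ} {V P : Set (List α)}
    (hpc : PrefixClosed P) (hcl : ClosedFor A V P)
    {rep : Set (List α) → List α} (hrep : IsRepFun A V P rep)
    {a : List α} (ha : a ∈ P) : (hypDFA A V P rep).eval a = row A V a := by
  induction a using List.reverseRecOn with
  | nil => rfl
  | append_singleton x b ih =>
    have hx : x ∈ P := hpc _ ha x (List.prefix_append x [b])
    rw [DFA.eval_append_singleton, ih hx]
    exact hypStep_row hcl hrep hx b

/-- Compatibility Theorem: every intermediate hypothesis DFA built from a finite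
prefix-closed observation set `P` (not assumed live complete) classifies each string of
`P` exactly as the target DFA does. -/
theorem hypDFA_compatible {α σ : Type*} [Fintype α] [Fintype σ]
    (A : DFA α σ) (V P : Set (List α)) (hPfin : P.Finite) (hpc : PrefixClosed P)
    (hnilP : ([] : List α) ∈ P) (hnilV : ([] : List α) ∈ V) (hcl : ClosedFor A V P)
    (rep : Set (List α) → List α) (hrep : IsRepFun A V P rep) :
    ∀ a ∈ P, (a ∈ (hypDFA A V P rep).accepts ↔ a ∈ A.accepts) := by
  intro a ha
  rw [DFA.mem_accepts, hypDFA_eval hpc hcl hrep ha]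
  change [] ∈ V ∧ a ++ [] ∈ A.accepts ↔ a ∈ A.accepts
  rw [List.append_nil, and_iff_right hnilV]
end
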